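/- arXiv:2502.11802 — 2 statements merged into one kernel-verified Lean document; each statement's English description precedes it below -/
import Mathlib

section
/- Let n ≥ 2 and 0 < r₀ < 1. Let u and v be real-valued functions that are continuous on the closed annulus {x ∈ ℝⁿ : r₀ ≤ |x| ≤ 1} and harmonic on the open annulus A(r₀,1) = {x ∈ ℝⁿ : r₀ < |x| < 1}, and assume v is radial, i.e. v(x) = g(|x|) for some function g. Assume the boundary conditions ∫_{|x|=1} (u − v) dσ = 0 and ∫_{|x|=r₀} (u − v) dσ = 0. Then for every p ∈ [1, ∞), ∫_{A(r₀,1)} |v|ᵖ dx ≤ ∫_{A(r₀,1)} |u|ᵖ dx. -/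
open MeasureTheory Filter Set

noncomputable section

/-- A function is harmonic on an open set `U ⊆ ℝⁿ` if it is twice continuously
differentiable there and its Laplacian (the sum of second partial derivatives)
vanishes on `U`. -/
def IsHarmonicOn {n : ℕ} (u : EuclideanSpace ℝ (Fin n) → ℝ)
    (U : Set (EuclideanSpace ℝ (Fin n))) : Prop :=
  ContDiffOn ℝ 2 u U ∧
    ∀ x ∈ U,
      (∑ i : Fin n,
        fderiv ℝ (fun y => fderiv ℝ u y (EuclideanSpace.single i (1 : ℝ))) x
          (EuclideanSpace.single i (1 : ℝ))) = 0


lemma aux_sphere_fin (m : ℕ) (r : ℝ) :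
    (μH[(m : ℝ)]) (Metric.sphere (0 : EuclideanSpace ℝ (Fin (m+1))) r) < ⊤ := by
  let f : Fin (m+1) → ℝ → (Fin m → ℝ) → EuclideanSpace ℝ (Fin (m+1)) := fun i s y =>
    WithLp.toLp 2 (Fin.insertNth (α := fun _ => ℝ) i s y)
  let h : Fin (m+1) → ℝ → (Fin m → ℝ) → EuclideanSpace ℝ (Fin (m+1)) := fun i s y =>
    (r * ‖f i s y‖⁻¹) • f i s y
  have hf : ∀ i s, ContDiff ℝ 1 (f i s) := by
    intro i s
    rw [contDiff_euclidean]
    intro j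
    rcases Fin.eq_self_or_eq_succAbove i j with rfl | ⟨k, rfl⟩
    · simp only [f, Fin.insertNth_apply_same]; exact contDiff_const
    · simp only [f, Fin.insertNth_apply_succAbove]; fun_prop
  have hne : ∀ i s y, s ≠ 0 → f i s y ≠ 0 := by
    intro i s y hs h0
    apply hs
    have := congrArg (fun z : EuclideanSpace ℝ (Fin (m+1)) => z i) h0
    simpa [f] using this
  have hh : ∀ i s, s ≠ 0 → ContDiff ℝ 1 (h i s) := by
    intro i s hs
    have h1 : ContDiff ℝ 1 (fun y => ‖f i s y‖) := (hf i s).norm ℝ (fun y => hne i s y hs)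
    exact (contDiff_const.mul (h1.inv fun y => norm_ne_zero_iff.2 (hne i s y hs))).smul (hf i s)
  have hfin : ∀ i s, s ≠ 0 → (μH[(m : ℝ)]) (h i s '' Metric.closedBall 0 1) < ⊤ := by
    intro i s hs
    obtain ⟨K, hK⟩ := ((hh i s hs).locallyLipschitz.locallyLipschitzOn
      (s := Metric.closedBall (0 : Fin m → ℝ) 1)).exists_lipschitzOnWith_of_compact
        (isCompact_closedBall _ _)
    refine (hK.hausdorffMeasure_image_le (Nat.cast_nonneg m)).trans_lt ?_
    have : (μH[(m : ℝ)] : Measure (Fin m → ℝ)) = volume := by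
      have := hausdorffMeasure_pi_real (ι := Fin m)
      simpa using this
    rw [this]
    refine ENNReal.mul_lt_top (by simp) (isCompact_closedBall _ _).measure_lt_top
  by_cases hr : r = 0
  · subst hr
    refine lt_of_le_of_lt (measure_mono ?_) (hfin 0 1 one_ne_zero)
    intro x hx
    refine ⟨0, by simp, ?_⟩
    simp at hx
    simp [h, hx]
  have hsub : Metric.sphere (0 : EuclideanSpace ℝ (Fin (m+1))) r ⊆
      (⋃ i, h i 1 '' Metric.closedBall 0 1) ∪ (⋃ i, h i (-1) '' Metric.closedBall 0 1) := by
    intro x hx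
    have hx' : ‖x‖ = r := by simpa using hx
    obtain ⟨i, -, hi⟩ := Finset.exists_max_image Finset.univ (fun i => |x i|) ⟨0, Finset.mem_univ _⟩
    have hxi : 0 < |x i| := by
      rw [abs_pos]
      intro h0
      apply hr
      rw [← hx', norm_eq_zero]
      ext j
      have := hi j (Finset.mem_univ _)
      simpa [h0] using this
    have key : ∀ s, |x i| * s = x i → h i s (fun j => x (i.succAbove j) / |x i|) = x := by
      intro s hs
      have e1 : f i s (fun j => x (i.succAbove j) / |x i|) = |x i|⁻¹ • x := by
        ext j
        rcases Fin.eq_self_or_eq_succAbove i j with rfl | ⟨k, rfl⟩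
        · simp [f]; field_simp; linarith
        · simp [f]; field_simp
      simp only [h, e1, norm_smul, hx', smul_smul]
      have : (r * (‖|x i|⁻¹‖ * r)⁻¹ * |x i|⁻¹) = 1 := by
        rw [Real.norm_of_nonneg (by positivity)]
        field_simp
      rw [this, one_smul]
    have hb : (fun j => x (i.succAbove j) / |x i|) ∈ Metric.closedBall (0 : Fin m → ℝ) 1 := by
      rw [mem_closedBall_zero_iff, pi_norm_le_iff_of_nonneg zero_le_one]
      intro j
      rw [Real.norm_eq_abs, abs_div, abs_abs, div_le_one hxi]
      exact hi _ (Finset.mem_univ _)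
    rcases le_total 0 (x i) with h0 | h0
    · left; exact mem_iUnion.2 ⟨i, _, hb, key 1 (by rw [abs_of_nonneg h0]; ring)⟩
    · right; exact mem_iUnion.2 ⟨i, _, hb, key (-1) (by rw [abs_of_nonpos h0]; ring)⟩
  refine (measure_mono hsub).trans_lt ((measure_union_le _ _).trans_lt (ENNReal.add_lt_top.2 ⟨?_, ?_⟩))
  · refine (measure_iUnion_le _).trans_lt ?_
    rw [tsum_fintype]
    exact ENNReal.sum_lt_top.2 fun i _ => hfin i 1 one_ne_zero
  · refine (measure_iUnion_le _).trans_lt ?_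
    rw [tsum_fintype]
    exact ENNReal.sum_lt_top.2 fun i _ => hfin i (-1) (by norm_num)

lemma aux_sphere_ne (m : ℕ) (r : ℝ) (hr : 0 < r) :
    (μH[(m : ℝ)]) (Metric.sphere (0 : EuclideanSpace ℝ (Fin (m+1))) r) ≠ 0 := by
  intro h0
  let q : EuclideanSpace ℝ (Fin (m+1)) → (Fin m → ℝ) := fun x j => x j.succ
  have hq : LipschitzWith 1 q := by
    refine LipschitzWith.of_dist_le_mul fun x y => ?_
    rw [NNReal.coe_one, one_mul, dist_pi_le_iff dist_nonneg]
    intro j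
    rw [dist_eq_norm, dist_eq_norm]
    exact PiLp.norm_apply_le (x - y) j.succ
  have h1 := hq.hausdorffMeasure_image_le (Nat.cast_nonneg m)
    (Metric.sphere (0 : EuclideanSpace ℝ (Fin (m+1))) r)
  rw [h0, mul_zero] at h1
  have : (μH[(m : ℝ)] : Measure (Fin m → ℝ)) = volume := by
    have := hausdorffMeasure_pi_real (ι := Fin m)
    simpa using this
  rw [this] at h1
  have hopen : IsOpen {y : Fin m → ℝ | ∑ j, y j ^ 2 < r ^ 2} :=
    isOpen_lt (by fun_prop) (by fun_prop)
  have hpos := hopen.measure_pos volume ⟨0, by simp; positivity⟩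
  refine absurd (measure_mono (μ := volume) ?_) (not_le.2 (lt_of_le_of_lt h1 hpos))
  intro y hy
  have hy' : ∑ j, y j ^ 2 < r ^ 2 := hy
  refine ⟨WithLp.toLp 2 (Fin.cons (√(r^2 - ∑ j, y j ^ 2)) y), ?_, ?_⟩
  · rw [mem_sphere_zero_iff_norm, EuclideanSpace.norm_eq, Fin.sum_univ_succ]
    simp only [Fin.cons_zero, Fin.cons_succ, Real.norm_eq_abs, sq_abs]
    rw [Real.sq_sqrt (by linarith), sub_add_cancel, Real.sqrt_sq hr.le]
  · ext j; simp [q]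

open InnerProductSpace Topology Laplacian

abbrev EE (n : ℕ) := EuclideanSpace ℝ (Fin n)
abbrev GG (n : ℕ) : Type := ↥(unitary (EE n →L[ℝ] EE n))

instance aux_star (n : ℕ) : ContinuousStar (EE n →L[ℝ] EE n) :=
  ⟨(ContinuousLinearMap.adjoint (𝕜 := ℝ) (E := EE n) (F := EE n)).continuous⟩

instance aux_tg (n : ℕ) : IsTopologicalGroup (GG n) := inferInstance

instance aux_compact (n : ℕ) : CompactSpace (GG n) := by
  refine isCompact_iff_compactSpace
    (s := ((unitary (EE n →L[ℝ] EE n) : Submonoid _) : Set (EE n →L[ℝ] EE n))).1 ?_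
  refine Metric.isCompact_of_isClosed_isBounded isClosed_unitary ?_
  refine (Metric.isBounded_closedBall (x := (0 : EE n →L[ℝ] EE n)) (r := 1)).subset ?_
  intro g hg
  rw [mem_closedBall_zero_iff]
  refine ContinuousLinearMap.opNorm_le_bound _ zero_le_one fun x => ?_
  rw [one_mul, Unitary.norm_map ⟨g, hg⟩ x]

def hm (n : ℕ) : Measure (GG n) := Measure.haarMeasure ⊤

instance aux_prob (n : ℕ) : IsProbabilityMeasure (hm n) := ⟨by
  have := Measure.haarMeasure_self (G := GG n) (K₀ := ⊤)
  simpa [hm] using this⟩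

instance aux_haar (n : ℕ) : (hm n).IsHaarMeasure := by unfold hm; infer_instance

/-- the action by the inverse -/
def act {n : ℕ} (g : GG n) : EE n →L[ℝ] EE n := ((g⁻¹ : GG n) : EE n →L[ℝ] EE n)

lemma act_norm {n : ℕ} (g : GG n) (x : EE n) : ‖act g x‖ = ‖x‖ := Unitary.norm_map _ _

lemma act_cont {n : ℕ} : Continuous (fun q : GG n × EE n => act q.1 q.2) := by
  have : Continuous (fun q : GG n × EE n => act q.1) := by
    unfold act
    exact continuous_subtype_val.comp (continuous_inv.comp continuous_fst)
  exact this.clm_apply continuous_snd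

lemma act_cont1 {n : ℕ} (x : EE n) : Continuous (fun g : GG n => act g x) :=
  (act_cont (n := n)).comp₂ continuous_id continuous_const

def actL {n : ℕ} (g : GG n) : EE n ≃ₗᵢ[ℝ] EE n := Unitary.linearIsometryEquiv g⁻¹

lemma actL_apply {n : ℕ} (g : GG n) (x : EE n) : actL g x = act g x := rfl

lemma param_deriv {n : ℕ} (a a' : GG n → ℝ → ℝ) (δ : ℝ)
    (h : ∀ g, ∀ t ∈ Ioo (-δ) δ, HasDerivAt (a g) (a' g t) t)
    (ca : ContinuousOn (fun q : GG n × ℝ => a q.1 q.2) (univ ×ˢ Icc (-δ) δ))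
    (ca' : ContinuousOn (fun q : GG n × ℝ => a' q.1 q.2) (univ ×ˢ Icc (-δ) δ)) :
    ∀ t ∈ Ioo (-δ) δ, HasDerivAt (fun t => ∫ g, a g t ∂(hm n)) (∫ g, a' g t ∂(hm n)) t := by
  intro t ht
  obtain ⟨C, hC⟩ := (isCompact_univ.prod isCompact_Icc).exists_bound_of_continuousOn ca'
  have c1 : ∀ s ∈ Ioo (-δ) δ, Continuous (fun g => a g s) := by
    intro s hs
    exact ca.comp_continuous (by fun_prop : Continuous fun g : GG n => (g, s))
      (fun g => ⟨mem_univ _, Ioo_subset_Icc_self hs⟩)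
  have c2 : ∀ s ∈ Ioo (-δ) δ, Continuous (fun g => a' g s) := by
    intro s hs
    exact ca'.comp_continuous (by fun_prop : Continuous fun g : GG n => (g, s))
      (fun g => ⟨mem_univ _, Ioo_subset_Icc_self hs⟩)
  refine (hasDerivAt_integral_of_dominated_loc_of_deriv_le (F := fun t g => a g t)
    (F' := fun t g => a' g t) (s := Ioo (-δ) δ) (bound := fun _ => C)
    (Ioo_mem_nhds ht.1 ht.2) ?_ ?_ ?_ ?_ ?_ ?_).2
  · filter_upwards [Ioo_mem_nhds ht.1 ht.2] with s hs using (c1 s hs).aestronglyMeasurable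
  · exact (c1 t ht).integrable_of_hasCompactSupport (HasCompactSupport.of_compactSpace _)
  · exact (c2 t ht).aestronglyMeasurable
  · exact Eventually.of_forall fun g s hs => hC (g, s) ⟨mem_univ _, Ioo_subset_Icc_self hs⟩
  · exact integrable_const _
  · exact Eventually.of_forall fun g s hs => h g s hs

lemma slice_int {n : ℕ} (a : GG n → ℝ → ℝ) (δ : ℝ)
    (ca : ContinuousOn (fun q : GG n × ℝ => a q.1 q.2) (univ ×ˢ Icc (-δ) δ)) (s : ℝ)
    (hs : s ∈ Icc (-δ) δ) : Integrable (fun g => a g s) (hm n) := by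
  have : Continuous (fun g => a g s) :=
    ca.comp_continuous (by fun_prop : Continuous fun g : GG n => (g, s))
      (fun g => ⟨mem_univ _, hs⟩)
  exact this.integrable_of_hasCompactSupport (HasCompactSupport.of_compactSpace _)

lemma second_test (f f' : ℝ → ℝ) (s : ℝ) (h1 : ∀ᶠ t in 𝓝 0, HasDerivAt f (f' t) t)
    (h2 : HasDerivAt f' s 0) (hm : IsLocalMax f 0) : s ≤ 0 := by
  by_contra hs
  push Not at hs
  have e : deriv f =ᶠ[𝓝 0] f' := h1.mono fun t ht => ht.deriv
  have d2 : deriv (deriv f) 0 = s := by rw [e.deriv_eq, h2.deriv]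
  have hmin := isLocalMin_of_deriv_deriv_pos (by rw [d2]; exact hs) hm.deriv_eq_zero
    h1.self_of_nhds.continuousAt
  have hc : f =ᶠ[𝓝 0] fun _ => f 0 := by
    filter_upwards [hm, hmin] with t ht ht'
    exact le_antisymm ht ht'
  have : deriv f =ᶠ[𝓝 0] fun _ => 0 := by
    have := hc.deriv
    simpa using this
  rw [this.deriv_eq] at d2
  simp at d2
  linarith

lemma harm_of {n : ℕ} {u : EE n → ℝ} {U : Set (EE n)} (hU : IsOpen U) (h : IsHarmonicOn u U) :
    HarmonicOnNhd u U := by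
  have key : ∀ x ∈ U, (Δ u) x = 0 := by
    intro x hx
    rw [laplacian_eq_iteratedFDeriv_orthonormalBasis u (EuclideanSpace.basisFun (Fin n) ℝ)]
    rw [← h.2 x hx]
    have hd : DifferentiableAt ℝ (fderiv ℝ u) x :=
      ((h.1.contDiffAt (hU.mem_nhds hx)).fderiv_right (m := 1) (by norm_num)).differentiableAt
        (by norm_num)
    refine Finset.sum_congr rfl fun i _ => ?_
    rw [iteratedFDeriv_two_apply, fderiv_clm_apply hd (differentiableAt_const _)]
    simp
  intro x hx
  refine ⟨h.1.contDiffAt (hU.mem_nhds hx), ?_⟩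
  filter_upwards [hU.mem_nhds hx] with y hy using key y hy

def AA (n : ℕ) (r₀ : ℝ) : Set (EE n) := {x | r₀ < ‖x‖ ∧ ‖x‖ < 1}
def KK (n : ℕ) (r₀ : ℝ) : Set (EE n) := {x | r₀ ≤ ‖x‖ ∧ ‖x‖ ≤ 1}

lemma AA_open (n : ℕ) (r₀ : ℝ) : IsOpen (AA n r₀) :=
  (isOpen_lt continuous_const continuous_norm).inter (isOpen_lt continuous_norm continuous_const)

lemma act_AA {n : ℕ} {r₀ : ℝ} {x : EE n} (g : GG n) (hx : x ∈ AA n r₀) : act g x ∈ AA n r₀ := by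
  simpa only [AA, mem_ofPred_eq, act_norm] using hx

lemma act_KK {n : ℕ} {r₀ : ℝ} {x : EE n} (g : GG n) (hx : x ∈ KK n r₀) : act g x ∈ KK n r₀ := by
  simpa only [KK, mem_ofPred_eq, act_norm] using hx

lemma avg_second {n : ℕ} {r₀ : ℝ} {w : EE n → ℝ} (hw : HarmonicOnNhd w (AA n r₀)) {x : EE n}
    (hx : x ∈ AA n r₀) : ∃ s : Fin n → ℝ, ∑ i, s i = 0 ∧ ∀ i, ∃ f' : ℝ → ℝ,
      (∀ᶠ t in 𝓝 (0 : ℝ), HasDerivAt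
        (fun t : ℝ => ∫ g, w (act g (x + t • EuclideanSpace.single i (1 : ℝ))) ∂(hm n)) (f' t) t) ∧
      HasDerivAt f' (s i) 0 := by
  have hO := AA_open n r₀
  have hc : ContDiffOn ℝ 2 w (AA n r₀) := hw.contDiffOn
  have cw : ContinuousOn w (AA n r₀) := hc.continuousOn
  have hc1 : ContDiffOn ℝ 1 (fderiv ℝ w) (AA n r₀) := hc.fderiv_of_isOpen hO (by norm_num)
  have cw1 : ContinuousOn (fderiv ℝ w) (AA n r₀) := hc1.continuousOn
  have cw2 : ContinuousOn (fderiv ℝ (fderiv ℝ w)) (AA n r₀) :=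
    hc1.continuousOn_fderiv_of_isOpen hO (by norm_num)
  have d0 : ∀ y ∈ AA n r₀, HasFDerivAt w (fderiv ℝ w y) y := fun y hy =>
    ((hc.contDiffAt (hO.mem_nhds hy)).differentiableAt (by norm_num)).hasFDerivAt
  have d1 : ∀ y ∈ AA n r₀, HasFDerivAt (fderiv ℝ w) (fderiv ℝ (fderiv ℝ w) y) y := fun y hy =>
    ((hc1.contDiffAt (hO.mem_nhds hy)).differentiableAt (by norm_num)).hasFDerivAt
  obtain ⟨δ, hδ, hball⟩ := Metric.nhds_basis_closedBall.mem_iff.1 (hO.mem_nhds hx)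
  let e : Fin n → EE n := fun i => EuclideanSpace.single i (1 : ℝ)
  have he : ∀ i, ‖e i‖ = 1 := fun i => by simp [e]
  have hmem : ∀ i, ∀ t ∈ Icc (-δ) δ, x + t • e i ∈ AA n r₀ := by
    intro i t ht
    apply hball
    rw [mem_closedBall_iff_norm, add_sub_cancel_left, norm_smul, he, mul_one, Real.norm_eq_abs]
    exact abs_le.2 ht
  have hmem' : ∀ i (g : GG n), ∀ t ∈ Icc (-δ) δ, act g (x + t • e i) ∈ AA n r₀ :=
    fun i g t ht => act_AA g (hmem i t ht)
  have hcurve : ∀ i (g : GG n) (t : ℝ), HasDerivAt (fun t : ℝ => act g (x + t • e i)) (act g (e i)) t := by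
    intro i g t
    have h1 : HasDerivAt (fun t : ℝ => x + t • e i) (e i) t := by
      simpa using ((hasDerivAt_id t).smul_const (e i)).const_add x
    exact (act g).hasFDerivAt.comp_hasDerivAt t h1
  have ccurve : ∀ i, Continuous (fun q : GG n × ℝ => act q.1 (x + q.2 • e i)) := fun i =>
    (act_cont (n := n)).comp₂ continuous_fst (by fun_prop)
  have ce : ∀ i, Continuous (fun q : GG n × ℝ => act q.1 (e i)) := fun i =>
    (act_cont (n := n)).comp₂ continuous_fst continuous_const
  have mt : ∀ i, MapsTo (fun q : GG n × ℝ => act q.1 (x + q.2 • e i)) (univ ×ˢ Icc (-δ) δ)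
      (AA n r₀) := fun i q hq => hmem' i q.1 q.2 hq.2
  let a : Fin n → GG n → ℝ → ℝ := fun i g t => w (act g (x + t • e i))
  let b : Fin n → GG n → ℝ → ℝ := fun i g t => fderiv ℝ w (act g (x + t • e i)) (act g (e i))
  let c : Fin n → GG n → ℝ → ℝ := fun i g t =>
    fderiv ℝ (fderiv ℝ w) (act g (x + t • e i)) (act g (e i)) (act g (e i))
  have ca : ∀ i, ContinuousOn (fun q : GG n × ℝ => a i q.1 q.2) (univ ×ˢ Icc (-δ) δ) := fun i =>
    cw.comp (ccurve i).continuousOn (mt i)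
  have cb : ∀ i, ContinuousOn (fun q : GG n × ℝ => b i q.1 q.2) (univ ×ˢ Icc (-δ) δ) := fun i =>
    (cw1.comp (ccurve i).continuousOn (mt i)).clm_apply (ce i).continuousOn
  have cc : ∀ i, ContinuousOn (fun q : GG n × ℝ => c i q.1 q.2) (univ ×ˢ Icc (-δ) δ) := fun i =>
    ((cw2.comp (ccurve i).continuousOn (mt i)).clm_apply (ce i).continuousOn).clm_apply
      (ce i).continuousOn
  have ab : ∀ i g, ∀ t ∈ Ioo (-δ) δ, HasDerivAt (a i g) (b i g t) t := fun i g t ht =>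
    (d0 _ (hmem' i g t (Ioo_subset_Icc_self ht))).comp_hasDerivAt t (hcurve i g t)
  have bc : ∀ i g, ∀ t ∈ Ioo (-δ) δ, HasDerivAt (b i g) (c i g t) t := by
    intro i g t ht
    have h1 := (d1 _ (hmem' i g t (Ioo_subset_Icc_self ht))).comp_hasDerivAt t (hcurve i g t)
    have h2 := h1.clm_apply (hasDerivAt_const t (act g (e i)))
    rw [map_zero, add_zero] at h2
    exact h2
  have h0 : (0 : ℝ) ∈ Ioo (-δ) δ := ⟨by linarith, hδ⟩
  refine ⟨fun i => ∫ g, c i g 0 ∂(hm n), ?_, fun i => ⟨fun t => ∫ g, b i g t ∂(hm n), ?_, ?_⟩⟩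
  · rw [← integral_finsetSum]
    · have : ∀ g, ∑ i, c i g 0 = 0 := by
        intro g
        have h1 : (Δ w) (act g x) = 0 := (hw _ (act_AA g hx)).2.self_of_nhds
        rw [laplacian_eq_iteratedFDeriv_orthonormalBasis w
          ((EuclideanSpace.basisFun (Fin n) ℝ).map (actL g))] at h1
        refine Eq.trans (Finset.sum_congr rfl fun i _ => ?_) h1
        rw [iteratedFDeriv_two_apply]
        simp [c, e, actL_apply]
      simp [this]
    · intro i _
      exact slice_int (c i) δ (cc i) 0 (Ioo_subset_Icc_self h0)
  · filter_upwards [Ioo_mem_nhds h0.1 h0.2] with t ht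
    exact param_deriv (a i) (b i) δ (ab i) (ca i) (cb i) t ht
  · exact param_deriv (b i) (c i) δ (bc i) (cb i) (cc i) 0 h0

lemma avg_const {n : ℕ} (w : EE n → ℝ) {x y : EE n} (h : ‖x‖ = ‖y‖) :
    ∫ g, w (act g y) ∂(hm n) = ∫ g, w (act g x) ∂(hm n) := by
  let k : GG n := Unitary.linearIsometryEquiv.symm (Submodule.reflection (ℝ ∙ (x - y))ᗮ)
  have hk : (k : EE n →L[ℝ] EE n) x = y := by
    have := Submodule.reflection_sub h
    simpa [k] using this
  have h1 := integral_mul_left_eq_self (μ := hm n) (fun g => w (act g x)) k⁻¹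
  rw [← h1]
  congr 1
  ext g
  have : act (k⁻¹ * g) x = act g y := by
    unfold act
    rw [mul_inv_rev, inv_inv, Submonoid.coe_mul, mul_apply_eq_comp, hk]
  rw [this]

lemma bdry {m : ℕ} {r : ℝ} (hr : 0 < r) (w : EE (m+1) → ℝ) (hw : Continuous w) (C : ℝ)
    (hC : ∀ x, ‖w x‖ ≤ C)
    (h0 : ∫ x in Metric.sphere (0 : EE (m+1)) r, w x ∂(μH[(m : ℝ)]) = 0) {y : EE (m+1)}
    (hy : ‖y‖ = r) : ∫ g, w (act g y) ∂(hm (m+1)) = 0 := by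
  set S := Metric.sphere (0 : EE (m+1)) r with hS
  have hfin := aux_sphere_fin m r
  have hne := aux_sphere_ne m r hr
  have hSm : MeasurableSet S := Metric.isClosed_sphere.measurableSet
  have : IsFiniteMeasure ((μH[(m : ℝ)] : Measure (EE (m+1))).restrict S) :=
    ⟨by rw [Measure.restrict_apply_univ]; exact hfin⟩
  have h1 : ∀ g : GG (m+1), ∫ x in S, w (act g x) ∂(μH[(m : ℝ)]) = 0 := by
    intro g
    have mp := (actL g).toIsometryEquiv.measurePreserving_hausdorffMeasure (m : ℝ)
    have h2 := mp.setIntegral_preimage_emb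
      (actL g).toIsometryEquiv.toHomeomorph.measurableEmbedding w S
    have hpre : (actL g).toIsometryEquiv ⁻¹' S = S := by
      ext x
      simp [hS]
    rw [hpre, h0] at h2
    exact h2
  have h2 : ∫ x in S, (∫ g, w (act g x) ∂(hm (m+1))) ∂(μH[(m : ℝ)]) = 0 := by
    rw [integral_integral_swap]
    · simp [h1]
    · have hc : Continuous (Function.uncurry fun (x : EE (m+1)) (g : GG (m+1)) => w (act g x)) :=
        hw.comp ((act_cont (n := m+1)).comp₂ continuous_snd continuous_fst)
      exact Integrable.of_bound hc.aestronglyMeasurable C (Eventually.of_forall fun q => hC _)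
  have h3 : ∫ x in S, (∫ g, w (act g x) ∂(hm (m+1))) ∂(μH[(m : ℝ)])
      = ∫ x in S, (∫ g, w (act g y) ∂(hm (m+1))) ∂(μH[(m : ℝ)]) := by
    refine setIntegral_congr_fun hSm fun x hx => ?_
    refine avg_const w ?_
    rw [hy]; exact (mem_sphere_zero_iff_norm.1 hx).symm
  rw [h3, setIntegral_const, smul_eq_mul] at h2
  rcases mul_eq_zero.1 h2 with h | h
  · exfalso
    rw [Measure.real, ENNReal.toReal_eq_zero_iff] at h
    rcases h with h | h
    · exact hne h
    · exact hfin.ne h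
  · exact h

lemma avg_le {m : ℕ} {r₀ : ℝ} (hr₀ : 0 < r₀) (w : EE (m+1) → ℝ) (hw : Continuous w)
    (C : ℝ) (hC : ∀ x, ‖w x‖ ≤ C) (hh : HarmonicOnNhd w (AA (m+1) r₀))
    (h0 : ∫ x in Metric.sphere (0 : EE (m+1)) r₀, w x ∂(μH[(m : ℝ)]) = 0)
    (h1 : ∫ x in Metric.sphere (0 : EE (m+1)) 1, w x ∂(μH[(m : ℝ)]) = 0) {x : EE (m+1)}
    (hx : x ∈ KK (m+1) r₀) : ∫ g, w (act g x) ∂(hm (m+1)) ≤ 0 := by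
  by_contra hpos
  push Not at hpos
  set F : EE (m+1) → ℝ := fun x => ∫ g, w (act g x) ∂(hm (m+1)) with hF
  have hFc : Continuous F := by
    have hc : Continuous (Function.uncurry fun (x : EE (m+1)) (g : GG (m+1)) => w (act g x)) :=
      hw.comp ((act_cont (n := m+1)).comp₂ continuous_snd continuous_fst)
    have := continuous_parametric_integral_of_continuous (μ := hm (m+1)) hc isCompact_univ
    simpa only [Measure.restrict_univ] using this
  have hpos' : 0 < F x := hpos
  set ε := F x / 2 with hε
  have hεp : 0 < ε := by positivity
  let H : EE (m+1) → ℝ := fun y => F y + ε * ‖y‖ ^ 2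
  have hHc : Continuous H := by fun_prop
  have hK : IsCompact (KK (m+1) r₀) := by
    refine Metric.isCompact_of_isClosed_isBounded ?_ ?_
    · exact (isClosed_le continuous_const continuous_norm).inter
        (isClosed_le continuous_norm continuous_const)
    · refine (Metric.isBounded_closedBall (x := (0 : EE (m+1))) (r := 1)).subset fun y hy => ?_
      exact mem_closedBall_zero_iff.2 hy.2
  obtain ⟨z, hz, hmax⟩ := hK.exists_isMaxOn ⟨x, hx⟩ hHc.continuousOn
  have hzx : H x ≤ H z := hmax hx
  have hxx : F x ≤ H x := by
    have : 0 ≤ ε * ‖x‖ ^ 2 := by positivity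
    simp only [H]; linarith
  have hz1 : ε * ‖z‖ ^ 2 ≤ ε := by
    have : ‖z‖ ^ 2 ≤ 1 := pow_le_one₀ (norm_nonneg _) hz.2
    nlinarith
  have hFz : 0 < F z := by
    have : H z = F z + ε * ‖z‖ ^ 2 := rfl
    linarith
  have hzA : z ∈ AA (m+1) r₀ := by
    refine ⟨lt_of_le_of_ne hz.1 fun h => ?_, lt_of_le_of_ne hz.2 fun h => ?_⟩
    · exact hFz.ne' (bdry hr₀ w hw C hC h0 h.symm)
    · exact hFz.ne' (bdry one_pos w hw C hC h1 h)
  obtain ⟨s, hs, hs'⟩ := avg_second hh hzA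
  have key : ∀ i, s i + 2 * ε ≤ 0 := by
    intro i
    obtain ⟨f', hf1, hf2⟩ := hs' i
    let e : EE (m+1) := EuclideanSpace.single i (1 : ℝ)
    have hN : ∀ t : ℝ, ‖z + t • e‖ ^ 2 = ‖z‖ ^ 2 + 2 * t * inner ℝ z e + t ^ 2 := by
      intro t
      rw [norm_add_sq_real, inner_smul_right, norm_smul]
      simp [e]; ring
    refine second_test (fun t => H (z + t • e))
      (fun t => f' t + ε * (2 * inner ℝ z e + 2 * t)) _ ?_ ?_ ?_
    · filter_upwards [hf1] with t ht
      simp only [H, hN]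
      refine HasDerivAt.add ht ?_
      refine HasDerivAt.const_mul ε ?_
      have h1 : HasDerivAt (fun t : ℝ => ‖z‖ ^ 2 + 2 * t * inner ℝ z e + t ^ 2)
          (2 * 1 * inner ℝ z e + (2 : ℕ) * t ^ (2 - 1) * 1) t :=
        ((((hasDerivAt_id t).const_mul 2).mul_const _).const_add _).add ((hasDerivAt_id t).pow 2)
      refine h1.congr_deriv ?_
      norm_num
    · refine hf2.add ?_
      have h1 : HasDerivAt (fun t : ℝ => ε * (2 * inner ℝ z e + 2 * t)) (ε * (2 * 1)) 0 :=
        (((hasDerivAt_id (0 : ℝ)).const_mul 2).const_add _).const_mul ε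
      refine h1.congr_deriv ?_
      ring
    · have hc : Tendsto (fun t : ℝ => z + t • e) (𝓝 0) (𝓝 z) := by
        have : Continuous (fun t : ℝ => z + t • e) := by fun_prop
        simpa using this.tendsto 0
      have := hc.eventually ((AA_open (m+1) r₀).mem_nhds hzA)
      filter_upwards [this] with t ht
      have h5 : H (z + t • e) ≤ H z := hmax ⟨ht.1.le, ht.2.le⟩
      simpa using h5
  have : ∑ i, (s i + 2 * ε) ≤ 0 := Finset.sum_nonpos fun i _ => key i
  rw [Finset.sum_add_distrib, hs, Finset.sum_const, zero_add, nsmul_eq_mul] at this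
  have h6 : 0 < ((Finset.univ : Finset (Fin (m+1))).card : ℝ) * (2 * ε) := by
    simp only [Finset.card_univ, Fintype.card_fin]
    positivity
  linarith

lemma avg_zero {m : ℕ} {r₀ : ℝ} (hr₀ : 0 < r₀) (w : EE (m+1) → ℝ) (hw : ContinuousOn w (KK (m+1) r₀))
    (hr₁ : r₀ < 1)
    (hh : HarmonicOnNhd w (AA (m+1) r₀))
    (h0 : ∫ x in Metric.sphere (0 : EE (m+1)) r₀, w x ∂(μH[(m : ℝ)]) = 0)
    (h1 : ∫ x in Metric.sphere (0 : EE (m+1)) 1, w x ∂(μH[(m : ℝ)]) = 0) {x : EE (m+1)}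
    (hx : x ∈ KK (m+1) r₀) : ∫ g, w (act g x) ∂(hm (m+1)) = 0 := by
  have hKc : IsClosed (KK (m+1) r₀) := (isClosed_le continuous_const continuous_norm).inter
        (isClosed_le continuous_norm continuous_const)
  have hK : IsCompact (KK (m+1) r₀) := by
    refine Metric.isCompact_of_isClosed_isBounded hKc ?_
    · refine (Metric.isBounded_closedBall (x := (0 : EE (m+1))) (r := 1)).subset fun y hy => ?_
      exact mem_closedBall_zero_iff.2 hy.2
  have := isCompact_iff_compactSpace.1 hK
  obtain ⟨W, -, hW⟩ := BoundedContinuousFunction.exists_norm_eq_domRestrict_eq_of_closed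
    (BoundedContinuousFunction.mkOfCompact ⟨_, hw.domRestrict⟩) hKc
  have hWw : ∀ y ∈ KK (m+1) r₀, W y = w y := fun y hy => by
    have := congrArg (fun f => f ⟨y, hy⟩) hW
    simpa using this
  have hWh : HarmonicOnNhd W (AA (m+1) r₀) := by
    intro y hy
    refine (harmonicAt_congr_nhds ?_).1 (hh y hy)
    filter_upwards [(AA_open (m+1) r₀).mem_nhds hy] with z hz
    exact (hWw z ⟨hz.1.le, hz.2.le⟩).symm
  have hs : ∀ r, r₀ ≤ r → r ≤ 1 → ∫ x in Metric.sphere (0 : EE (m+1)) r, W x ∂(μH[(m : ℝ)])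
      = ∫ x in Metric.sphere (0 : EE (m+1)) r, w x ∂(μH[(m : ℝ)]) := by
    intro r h h'
    refine setIntegral_congr_fun Metric.isClosed_sphere.measurableSet fun y hy => hWw y ?_
    rw [mem_sphere_zero_iff_norm] at hy
    exact ⟨by rw [hy]; exact h, by rw [hy]; exact h'⟩
  rw [← hs _ le_rfl hr₁.le] at h0
  rw [← hs _ hr₁.le le_rfl] at h1
  have e : ∫ g, w (act g x) ∂(hm (m+1)) = ∫ g, W (act g x) ∂(hm (m+1)) := by
    congr 1; ext g; exact (hWw _ (act_KK g hx)).symm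
  rw [e]
  refine le_antisymm (avg_le hr₀ W W.continuous ‖W‖ W.norm_coe_le_norm hWh h0 h1 hx) ?_
  have := avg_le hr₀ (fun y => -W y) W.continuous.neg ‖W‖ (fun y => by simpa using W.norm_coe_le_norm y) hWh.neg
    (by simp [integral_neg, h0]) (by simp [integral_neg, h1]) hx
  rw [integral_neg] at this
  linarith

lemma final {m : ℕ} {r₀ : ℝ} (hr₀ : 0 < r₀) (hr₁ : r₀ < 1)
    (u v : EE (m+1) → ℝ) (hu : ContinuousOn u (KK (m+1) r₀)) (hv : ContinuousOn v (KK (m+1) r₀))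
    (huh : HarmonicOnNhd u (AA (m+1) r₀)) (hvh : HarmonicOnNhd v (AA (m+1) r₀))
    (hv_radial : ∃ g : ℝ → ℝ, ∀ x, v x = g ‖x‖)
    (h1 : ∫ x in Metric.sphere (0 : EE (m+1)) 1, (u x - v x) ∂(μH[(m : ℝ)]) = 0)
    (h0 : ∫ x in Metric.sphere (0 : EE (m+1)) r₀, (u x - v x) ∂(μH[(m : ℝ)]) = 0)
    (p : ℝ) (hp : 1 ≤ p) :
    ∫⁻ x in AA (m+1) r₀, ENNReal.ofReal (|v x| ^ p) ≤
      ∫⁻ x in AA (m+1) r₀, ENNReal.ofReal (|u x| ^ p) := by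
  have hAm : MeasurableSet (AA (m+1) r₀) := (AA_open _ _).measurableSet
  have hp0 : 0 ≤ p := by linarith
  have hAK : AA (m+1) r₀ ⊆ KK (m+1) r₀ := fun x hx => ⟨hx.1.le, hx.2.le⟩
  obtain ⟨γ, hγ⟩ := hv_radial
  have hvr : ∀ g x, v (act g x) = v x := fun g x => by rw [hγ, hγ, act_norm]
  have cu : ∀ x ∈ KK (m+1) r₀, Continuous (fun g : GG (m+1) => u (act g x)) := fun x hx =>
    hu.comp_continuous (act_cont1 x) fun g => act_KK g hx
  have ci : ∀ f : GG (m+1) → ℝ, Continuous f → Integrable f (hm (m+1)) := fun f hf =>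
    hf.integrable_of_hasCompactSupport (HasCompactSupport.of_compactSpace _)
  have hvu : ∀ x ∈ KK (m+1) r₀, v x = ∫ g, u (act g x) ∂(hm (m+1)) := by
    intro x hx
    have := avg_zero hr₀ (u - v) (hu.sub hv) hr₁ (huh.sub hvh) h0 h1 hx
    simp only [Pi.sub_apply, hvr] at this
    rw [integral_sub (ci _ (cu x hx)) (integrable_const _)] at this
    simp at this
    linarith
  let U : EE (m+1) → ENNReal := (AA (m+1) r₀).indicator fun x => ENNReal.ofReal (|u x| ^ p)
  have hUm : Measurable U := by
    have hc : ContinuousOn (fun x => ENNReal.ofReal (|u x| ^ p)) (AA (m+1) r₀) :=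
      ENNReal.continuous_ofReal.comp_continuousOn
        (((hu.mono hAK).abs).rpow_const fun x _ => Or.inr hp0)
    classical
    have := hc.measurable_piecewise (g := fun _ => (0 : ENNReal)) continuousOn_const hAm
    have e := piecewise_eq_indicator (s := AA (m+1) r₀)
      (f := fun x => ENNReal.ofReal (|u x| ^ p))
    have h2 : Measurable ((AA (m+1) r₀).piecewise (fun x => ENNReal.ofReal (|u x| ^ p)) 0) := this
    rw [e] at h2
    exact h2
  have hle : ∀ x ∈ AA (m+1) r₀, ENNReal.ofReal (|v x| ^ p) ≤ ∫⁻ g, U (act g x) ∂(hm (m+1)) := by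
    intro x hx
    have hxK := hAK hx
    have cp : Continuous (fun g : GG (m+1) => |u (act g x)| ^ p) :=
      (cu x hxK).abs.rpow_const fun _ => Or.inr hp0
    have e1 : ∫⁻ g, U (act g x) ∂(hm (m+1)) = ENNReal.ofReal (∫ g, |u (act g x)| ^ p ∂(hm (m+1))) := by
      rw [ofReal_integral_eq_lintegral_ofReal (ci _ cp)
        (Eventually.of_forall fun g => by positivity)]
      refine lintegral_congr fun g => ?_
      exact indicator_of_mem (act_AA g hx) _
    rw [e1]
    apply ENNReal.ofReal_le_ofReal
    have j := (convexOn_rpow hp).map_integral_le (μ := hm (m+1)) (f := fun g => |u (act g x)|)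
      (continuousOn_id.rpow_const fun _ _ => Or.inr hp0) isClosed_Ici
      (Eventually.of_forall fun g => mem_Ici.2 (abs_nonneg _)) (ci _ (cu x hxK).abs) (ci _ cp)
    refine le_trans ?_ j
    refine Real.rpow_le_rpow (abs_nonneg _) ?_ hp0
    rw [hvu x hxK]
    exact abs_integral_le_integral_abs
  calc ∫⁻ x in AA (m+1) r₀, ENNReal.ofReal (|v x| ^ p)
      ≤ ∫⁻ x in AA (m+1) r₀, ∫⁻ g, U (act g x) ∂(hm (m+1)) := setLIntegral_mono' hAm hle
    _ ≤ ∫⁻ x, ∫⁻ g, U (act g x) ∂(hm (m+1)) := setLIntegral_le_lintegral _ _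
    _ = ∫⁻ g, (∫⁻ x, U (act g x)) ∂(hm (m+1)) := by
        refine lintegral_lintegral_swap ?_
        have hc : Continuous (fun q : EE (m+1) × GG (m+1) => act q.2 q.1) :=
          (act_cont (n := m+1)).comp₂ continuous_snd continuous_fst
        exact (hUm.comp hc.measurable).aemeasurable
    _ = ∫⁻ g, (∫⁻ x, U x) ∂(hm (m+1)) := by
        refine lintegral_congr fun g => ?_
        exact (actL g).measurePreserving.lintegral_comp hUm
    _ = ∫⁻ x, U x := by simp
    _ = _ := lintegral_indicator hAm _

theorem radial_harmonic_Lp_minimal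
    (n : ℕ) (hn : 2 ≤ n) (r₀ : ℝ) (hr₀ : 0 < r₀) (hr₁ : r₀ < 1)
    (u v : EuclideanSpace ℝ (Fin n) → ℝ)
    (hu_cont : ContinuousOn u {x | r₀ ≤ ‖x‖ ∧ ‖x‖ ≤ 1})
    (hv_cont : ContinuousOn v {x | r₀ ≤ ‖x‖ ∧ ‖x‖ ≤ 1})
    (hu_harm : IsHarmonicOn u {x | r₀ < ‖x‖ ∧ ‖x‖ < 1})
    (hv_harm : IsHarmonicOn v {x | r₀ < ‖x‖ ∧ ‖x‖ < 1})
    (hv_radial : ∃ g : ℝ → ℝ, ∀ x, v x = g ‖x‖)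
    (hb1 : (∫ x in Metric.sphere (0 : EuclideanSpace ℝ (Fin n)) 1,
        (u x - v x) ∂(μH[(n : ℝ) - 1])) = 0)
    (hbr : (∫ x in Metric.sphere (0 : EuclideanSpace ℝ (Fin n)) r₀,
        (u x - v x) ∂(μH[(n : ℝ) - 1])) = 0) :
    ∀ p : ℝ, 1 ≤ p →
      (∫⁻ x in {x : EuclideanSpace ℝ (Fin n) | r₀ < ‖x‖ ∧ ‖x‖ < 1},
          ENNReal.ofReal (|v x| ^ p)) ≤
        ∫⁻ x in {x : EuclideanSpace ℝ (Fin n) | r₀ < ‖x‖ ∧ ‖x‖ < 1},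
          ENNReal.ofReal (|u x| ^ p) := by
  intro p hp
  obtain ⟨m, rfl⟩ : ∃ m, n = m + 1 := ⟨n - 1, by omega⟩
  have hm1 : ((m + 1 : ℕ) : ℝ) - 1 = (m : ℝ) := by push_cast; ring
  rw [hm1] at hb1 hbr
  exact final hr₀ hr₁ u v hu_cont hv_cont (harm_of (AA_open _ _) hu_harm)
    (harm_of (AA_open _ _) hv_harm) hv_radial hb1 hbr p hp
end
end

section
/- Let n ≥ 2, let 0 < ρ₀ < ρ₁, and let h be harmonic on the open annulus A(ρ₀,ρ₁) = {x ∈ ℝⁿ : ρ₀ < |x| < ρ₁}. Define φ : (ρ₀,ρ₁) → ℝ by φ(r) = ∫_{S^{n−1}} h(rθ) dσ(θ), the integral of h over the sphere of radius r written via the unit sphere. Then φ is twice differentiable on (ρ₀,ρ₁) and satisfies the ordinary differential equation φ''(r) + ((n−1)/r) φ'(r) = 0 for all r ∈ (ρ₀,ρ₁). -/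
open MeasureTheory Filter Set ENNReal

noncomputable section

open scoped Topology NNReal

lemma aux_image_finite {m : ℕ} {F : Type*} [NormedAddCommGroup F] [NormedSpace ℝ F]
    [MeasurableSpace F] [BorelSpace F] (f : (Fin m → ℝ) → F) (hf : ContDiff ℝ 1 f)
    {K : Set (Fin m → ℝ)} (hK : IsCompact K) : μH[(m : ℝ)] (f '' K) < ⊤ := by
  refine hK.induction_on (p := fun s => μH[(m : ℝ)] (f '' s) < ⊤) (by simp) ?_ ?_ ?_
  · intro s t hst ht
    exact (measure_mono (image_mono hst)).trans_lt ht
  · intro s t hs ht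
    rw [image_union]
    exact (measure_union_le _ _).trans_lt (ENNReal.add_lt_top.2 ⟨hs, ht⟩)
  · intro x hx
    obtain ⟨C, t, ht, hl⟩ := (hf.contDiffAt (x := x)).exists_lipschitzOnWith
    obtain ⟨ε, hε, hb⟩ := Metric.mem_nhds_iff.1 ht
    refine ⟨Metric.ball x ε, mem_nhdsWithin_of_mem_nhds (Metric.ball_mem_nhds x hε), ?_⟩
    refine ((hl.mono hb).hausdorffMeasure_image_le (Nat.cast_nonneg m)).trans_lt ?_
    refine ENNReal.mul_lt_top (ENNReal.rpow_lt_top_of_nonneg (Nat.cast_nonneg m)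
      ENNReal.coe_ne_top) ?_
    have := hausdorffMeasure_pi_real (ι := Fin m)
    rw [Fintype.card_fin] at this
    rw [this]
    exact Metric.isBounded_ball.measure_lt_top

lemma aux_sphere_finite (m : ℕ) :
    μH[(m : ℝ)] (Metric.sphere (0 : EuclideanSpace ℝ (Fin (m+1))) 1) < ⊤ := by
  let w : Fin (m+1) → ℝ → (Fin m → ℝ) → EuclideanSpace ℝ (Fin (m+1)) :=
    fun i c v => WithLp.toLp 2 (i.insertNth c v)
  have hw : ∀ i c, ContDiff ℝ 1 (w i c) := by
    intro i c
    rw [contDiff_euclidean]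
    intro j
    refine Fin.succAboveCases i ?_ ?_ j
    · simp only [w, Fin.insertNth_apply_same]; fun_prop
    · intro k
      simp only [w, Fin.insertNth_apply_succAbove]; fun_prop
  have hw0 : ∀ i c v, c ≠ 0 → w i c v ≠ 0 := by
    intro i c v hc h0
    apply hc
    have := congrArg (fun z : EuclideanSpace ℝ (Fin (m+1)) => z i) h0
    simpa [w] using this
  have hf : ∀ i c, c ≠ 0 → ContDiff ℝ 1 (fun v => ‖w i c v‖⁻¹ • w i c v) := by
    intro i c hc
    exact ((((hw i c).norm ℝ (fun v => hw0 i c v hc)).inv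
      (fun v => norm_ne_zero_iff.2 (hw0 i c v hc))).smul (hw i c))
  have hfin : ∀ i c, c ≠ 0 →
      μH[(m : ℝ)] ((fun v => ‖w i c v‖⁻¹ • w i c v) '' Metric.closedBall 0 1) < ⊤ :=
    fun i c hc => aux_image_finite _ (hf i c hc) (isCompact_closedBall _ _)
  have hsub : Metric.sphere (0 : EuclideanSpace ℝ (Fin (m+1))) 1 ⊆
      ⋃ i : Fin (m+1), (((fun v => ‖w i 1 v‖⁻¹ • w i 1 v) '' Metric.closedBall 0 1) ∪
        ((fun v => ‖w i (-1) v‖⁻¹ • w i (-1) v) '' Metric.closedBall 0 1)) := by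
    intro x hx
    have hx1 : ‖x‖ = 1 := by simpa using hx
    obtain ⟨i, hi⟩ := Finite.exists_max (fun i => |x i|)
    have hxi : x i ≠ 0 := by
      intro h0
      have : x = 0 := by
        ext j
        have := hi j
        simp only [h0, abs_zero] at this
        simpa using this
      simp [this] at hx1
    have hpos : 0 < |x i| := abs_pos.2 hxi
    have key : ∀ c : ℝ, x i = |x i| * c →
        x ∈ (fun v => ‖w i c v‖⁻¹ • w i c v) '' Metric.closedBall 0 1 := by
      intro c hc
      refine ⟨fun k => |x i|⁻¹ * x (i.succAbove k), ?_, ?_⟩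
      · rw [mem_closedBall_zero_iff, pi_norm_le_iff_of_nonneg zero_le_one]
        intro k
        rw [Real.norm_eq_abs, abs_mul, abs_inv, abs_abs, inv_mul_le_iff₀ hpos, mul_one]
        exact hi _
      · have : w i c (fun k => |x i|⁻¹ * x (i.succAbove k)) = |x i|⁻¹ • x := by
          ext j
          refine Fin.succAboveCases i ?_ ?_ j
          · simp only [w, Fin.insertNth_apply_same, PiLp.smul_apply, smul_eq_mul]
            rw [eq_inv_mul_iff_mul_eq₀ hpos.ne', ← hc]
          · intro k
            simp only [w, Fin.insertNth_apply_succAbove, PiLp.smul_apply, smul_eq_mul]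
        simp only [this, norm_smul, hx1, smul_smul]
        rw [norm_inv, Real.norm_eq_abs, abs_abs, mul_one, inv_inv, mul_inv_cancel₀ hpos.ne',
          one_smul]
    refine mem_iUnion.2 ⟨i, ?_⟩
    rcases abs_choice (x i) with h | h
    · left; exact key 1 (by rw [h, mul_one])
    · right; exact key (-1) (by rw [h]; ring)
  refine (measure_mono hsub).trans_lt ((measure_iUnion_fintype_le _ _).trans_lt ?_)
  refine ENNReal.sum_lt_top.2 fun i _ => (measure_union_le _ _).trans_lt ?_
  exact ENNReal.add_lt_top.2 ⟨hfin i 1 one_ne_zero, hfin i (-1) (by norm_num)⟩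

lemma aux_hasDeriv {E : Type*} [NormedAddCommGroup E] [MeasurableSpace E] [BorelSpace E]
    (μ : Measure E) {S : Set E} (hS : IsCompact S) (hμ : μ S ≠ ⊤)
    (F F' : ℝ → E → ℝ) {U : Set ℝ} (hU : IsOpen U) {r : ℝ} (hr : r ∈ U)
    (hF : ∀ s ∈ U, ContinuousOn (F s) S)
    (hF' : ContinuousOn (fun p : ℝ × E => F' p.1 p.2) (U ×ˢ S))
    (hd : ∀ s ∈ U, ∀ θ ∈ S, HasDerivAt (fun s => F s θ) (F' s θ) s) :
    IntegrableOn (F' r) S μ ∧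
    HasDerivAt (fun s => ∫ θ in S, F s θ ∂μ) (∫ θ in S, F' r θ ∂μ) r := by
  obtain ⟨ε, hε, hb⟩ := Metric.nhds_basis_closedBall.mem_iff.1 (hU.mem_nhds hr)
  have hm := hS.measurableSet
  have hint : ∀ f : E → ℝ, ContinuousOn f S → IntegrableOn f S μ := fun f hf =>
    hf.integrableOn_of_subset_isCompact hS hm Subset.rfl hμ
  obtain ⟨C, hC⟩ := ((isCompact_closedBall r ε).prod hS).exists_bound_of_continuousOn
    (hF'.mono (prod_mono hb Subset.rfl))
  have hF'r : ContinuousOn (F' r) S :=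
    hF'.comp (f := fun θ : E => (r, θ)) (by fun_prop) (fun θ hθ => ⟨hr, hθ⟩)
  refine hasDerivAt_integral_of_dominated_loc_of_deriv_le (bound := fun _ => C)
    (Metric.closedBall_mem_nhds r hε) ?_ (hint _ (hF r hr)) (hint _ hF'r).aestronglyMeasurable
    ?_ ?_ ?_
  · filter_upwards [hU.mem_nhds hr] with s hs
    exact (hint _ (hF s hs)).aestronglyMeasurable
  · filter_upwards [ae_restrict_mem hm] with θ hθ s hs
    exact hC (s, θ) ⟨hs, hθ⟩
  · exact hint _ continuousOn_const
  · filter_upwards [ae_restrict_mem hm] with θ hθ s hs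
    exact hd s (hb hs) θ hθ

abbrev AuxE (n : ℕ) := EuclideanSpace ℝ (Fin n)

lemma aux_rot {n : ℕ} (hfin : μH[(n : ℝ) - 1] (Metric.sphere (0 : AuxE n) 1) ≠ ⊤)
    (A : AuxE n →L[ℝ] AuxE n) (hA : A ∈ skewAdjoint (AuxE n →L[ℝ] AuxE n))
    {U : Set (AuxE n)} (hU : IsOpen U) (g : AuxE n → ℝ) (hg : ContDiffOn ℝ 1 g U)
    {r : ℝ} (hr : 0 < r) (hrU : ∀ x : AuxE n, ‖x‖ = r → x ∈ U) :
    IntegrableOn (fun θ => fderiv ℝ g (r • θ) (A θ)) (Metric.sphere (0 : AuxE n) 1)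
      μH[(n : ℝ) - 1] ∧
    ∫ θ in Metric.sphere (0 : AuxE n) 1, fderiv ℝ g (r • θ) (A θ) ∂(μH[(n : ℝ) - 1]) = 0 := by
  set S := Metric.sphere (0 : AuxE n) 1 with hS
  let R : ℝ → AuxE n →L[ℝ] AuxE n := fun t => NormedSpace.exp (t • A)
  letI : NormedAlgebra ℚ (AuxE n →L[ℝ] AuxE n) := NormedAlgebra.restrictScalars ℚ ℝ _
  have hRu : ∀ t, R t ∈ unitary (AuxE n →L[ℝ] AuxE n) := fun t =>
    NormedSpace.exp_mem_unitary_of_mem_skewAdjoint (skewAdjoint.smul_mem t hA)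
  have hRd : ∀ t, HasDerivAt R (A * R t) t := fun t => hasDerivAt_exp_smul_const' A t
  have hRc : Continuous R := continuous_iff_continuousAt.2 fun t => (hRd t).continuousAt
  let e : ℝ → AuxE n ≃ₗᵢ[ℝ] AuxE n := fun t => Unitary.linearIsometryEquiv ⟨R t, hRu t⟩
  have he : ∀ t x, e t x = R t x := fun t x => rfl
  have hmem : ∀ t, ∀ θ ∈ S, r • R t θ ∈ U := by
    intro t θ hθ
    apply hrU
    have h1 : ‖θ‖ = 1 := by simpa [hS] using hθ
    rw [← he, norm_smul, (e t).norm_map, h1, Real.norm_eq_abs, abs_of_pos hr, mul_one]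
  have hconst : ∀ t, ∫ θ in S, g (r • R t θ) ∂(μH[(n : ℝ) - 1])
      = ∫ θ in S, g (r • θ) ∂(μH[(n : ℝ) - 1]) := by
    intro t
    have hp := (e t).toIsometryEquiv.measurePreserving_hausdorffMeasure ((n : ℝ) - 1)
    have := hp.setIntegral_preimage_emb
      (e t).toIsometryEquiv.toHomeomorph.measurableEmbedding (fun θ => g (r • θ)) S
    have hpre : (e t).toIsometryEquiv ⁻¹' S = S := by
      ext x
      simp [hS]
    rw [hpre] at this
    exact this
  have hg' : ContinuousOn (fderiv ℝ g) U := hg.continuousOn_fderiv_of_isOpen hU le_rfl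
  have hcR : Continuous (fun p : ℝ × AuxE n => R p.1 p.2) :=
    (hRc.comp continuous_fst).clm_apply continuous_snd
  obtain ⟨hi, hd⟩ := aux_hasDeriv μH[(n : ℝ) - 1] (isCompact_sphere (0 : AuxE n) 1) hfin
    (fun t θ => g (r • R t θ)) (fun t θ => fderiv ℝ g (r • R t θ) (r • (A * R t) θ))
    isOpen_univ (mem_univ (0 : ℝ))
    (fun t _ => hg.continuousOn.comp (by fun_prop) (fun θ hθ => hmem t θ hθ))
    (by
      refine ContinuousOn.clm_apply (hg'.comp (f := fun p : ℝ × AuxE n => r • R p.1 p.2)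
        (by fun_prop) (fun p hp => hmem p.1 p.2 hp.2)) ?_
      have : Continuous (fun p : ℝ × AuxE n => r • A (R p.1 p.2)) := by fun_prop
      exact this.continuousOn)
    (by
      intro t _ θ hθ
      have h1 : HasFDerivAt g (fderiv ℝ g (r • R t θ)) (r • R t θ) :=
        ((hg.differentiableOn one_ne_zero).differentiableAt
          (hU.mem_nhds (hmem t θ hθ))).hasFDerivAt
      have h2 : HasDerivAt (fun t => r • R t θ) (r • (A * R t) θ) t := by
        have := ((hRd t).clm_apply (hasDerivAt_const t θ)).const_smul r
        simp only [map_zero, add_zero] at this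
        exact this
      exact h1.comp_hasDerivAt t h2)
  have hR0 : R 0 = 1 := by
    have h00 : (0:ℝ) • A = 0 := by ext x; simp
    change NormedSpace.exp ((0:ℝ) • A) = 1
    exact (congrArg NormedSpace.exp h00).trans NormedSpace.exp_zero
  simp only [hR0, mul_one, one_apply_eq_self, map_smul, smul_eq_mul] at hi hd
  rw [integral_const_mul] at hd
  constructor
  · have := hi.const_mul r⁻¹
    refine this.congr (Filter.Eventually.of_forall fun θ => ?_)
    simp only
    field_simp
  · have h0 := (hasDerivAt_const (0:ℝ) (∫ θ in S, g (r • θ) ∂(μH[(n : ℝ) - 1])))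
    have := hd.unique (h0.congr_of_eventuallyEq (Filter.Eventually.of_forall hconst))
    exact (mul_eq_zero.1 this).resolve_left hr.ne'

def auxA {n : ℕ} (i j : Fin n) : AuxE n →L[ℝ] AuxE n :=
  (EuclideanSpace.proj i : AuxE n →L[ℝ] ℝ).smulRight (EuclideanSpace.single j (1:ℝ)) -
  (EuclideanSpace.proj j : AuxE n →L[ℝ] ℝ).smulRight (EuclideanSpace.single i (1:ℝ))

lemma auxA_apply {n : ℕ} (i j : Fin n) (x : AuxE n) : auxA i j x =
    x i • EuclideanSpace.single j (1:ℝ) - x j • EuclideanSpace.single i (1:ℝ) := by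
  simp [auxA]

lemma auxA_skew {n : ℕ} (i j : Fin n) : auxA i j ∈ skewAdjoint (AuxE n →L[ℝ] AuxE n) := by
  rw [skewAdjoint.mem_iff, ContinuousLinearMap.star_eq_adjoint, eq_comm,
    ContinuousLinearMap.eq_adjoint_iff]
  intro x y
  simp only [_root_.neg_apply, auxA_apply, inner_neg_left, inner_sub_left,
    inner_sub_right, inner_smul_left, inner_smul_right, EuclideanSpace.inner_single_left,
    EuclideanSpace.inner_single_right]
  simp
  ring

lemma aux_expand {n : ℕ} (x : AuxE n) :
    ∑ i, x i • EuclideanSpace.single i (1:ℝ) = x := by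
  ext k
  simp [Pi.single_apply]

lemma auxA_sq {n : ℕ} (x : AuxE n) :
    ∑ i, ∑ j, auxA i j (auxA i j x) = (-(2 * ((n : ℝ) - 1))) • x := by
  ext k
  simp only [auxA_apply]
  simp [Pi.single_apply, Finset.sum_sub_distrib, sub_mul, mul_sub]
  ring

lemma auxA_bil {n : ℕ} (B : AuxE n →L[ℝ] AuxE n →L[ℝ] ℝ) (x : AuxE n) :
    ∑ i, ∑ j, B (auxA i j x) (auxA i j x) = 2 * (‖x‖^2 * ∑ i,
      B (EuclideanSpace.single i (1:ℝ)) (EuclideanSpace.single i (1:ℝ)) - B x x) := by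
  have hB : B x x = ∑ i, ∑ j, x i * x j *
      B (EuclideanSpace.single i (1:ℝ)) (EuclideanSpace.single j (1:ℝ)) := by
    conv_lhs => rw [← aux_expand x]
    simp only [map_sum, map_smul, _root_.sum_apply, _root_.smul_apply,
      smul_eq_mul, Finset.mul_sum]
    rw [Finset.sum_comm]
    exact Finset.sum_congr rfl fun i _ => Finset.sum_congr rfl fun j _ => by ring
  have hB' : B x x = ∑ i, ∑ j, x i * x j *
      B (EuclideanSpace.single j (1:ℝ)) (EuclideanSpace.single i (1:ℝ)) := by
    rw [hB, Finset.sum_comm]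
    exact Finset.sum_congr rfl fun i _ => Finset.sum_congr rfl fun j _ => by ring
  have h1 : ‖x‖^2 * ∑ i, B (EuclideanSpace.single i (1:ℝ)) (EuclideanSpace.single i (1:ℝ)) =
      ∑ i, ∑ j, x i ^ 2 * B (EuclideanSpace.single j (1:ℝ)) (EuclideanSpace.single j (1:ℝ)) := by
    rw [EuclideanSpace.real_norm_sq_eq, Finset.sum_mul_sum]
  have h2 : ‖x‖^2 * ∑ i, B (EuclideanSpace.single i (1:ℝ)) (EuclideanSpace.single i (1:ℝ)) =
      ∑ i, ∑ j, x j ^ 2 * B (EuclideanSpace.single i (1:ℝ)) (EuclideanSpace.single i (1:ℝ)) := by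
    rw [h1, Finset.sum_comm]
  have h3 : ∀ a b : ℝ, 2 * (a - b) = a + a - b - b := by intros; ring
  rw [h3]
  nth_rewrite 1 [h1]
  rw [h2]
  nth_rewrite 1 [hB]
  rw [hB']
  simp only [← Finset.sum_add_distrib, ← Finset.sum_sub_distrib]
  refine Finset.sum_congr rfl fun i _ => Finset.sum_congr rfl fun j _ => ?_
  simp only [auxA_apply, map_sub, map_smul, _root_.sub_apply,
    _root_.smul_apply, smul_eq_mul]
  ring

theorem sphere_average_ODE (n : ℕ) (hn : 2 ≤ n) (ρ₀ ρ₁ : ℝ) (hρ₀ : 0 < ρ₀)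
    (hρ : ρ₀ < ρ₁) (h : EuclideanSpace ℝ (Fin n) → ℝ)
    (hharm : IsHarmonicOn h {x | ρ₀ < ‖x‖ ∧ ‖x‖ < ρ₁}) :
    ∃ φ' φ'' : ℝ → ℝ,
      ∀ r ∈ Set.Ioo ρ₀ ρ₁,
        HasDerivAt (fun s : ℝ =>
            ∫ θ in Metric.sphere (0 : EuclideanSpace ℝ (Fin n)) 1,
              h (s • θ) ∂(μH[(n : ℝ) - 1])) (φ' r) r ∧
        HasDerivAt φ' (φ'' r) r ∧
        φ'' r + ((n : ℝ) - 1) / r * φ' r = 0 := by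
  obtain ⟨hC, hL⟩ := hharm
  set U : Set (AuxE n) := {x | ρ₀ < ‖x‖ ∧ ‖x‖ < ρ₁} with hUdef
  have hU : IsOpen U :=
    (isOpen_lt continuous_const continuous_norm).inter (isOpen_lt continuous_norm continuous_const)
  have hfin : μH[(n : ℝ) - 1] (Metric.sphere (0 : AuxE n) 1) ≠ ⊤ := by
    obtain ⟨m, rfl⟩ : ∃ m, n = m + 1 := ⟨n - 1, by omega⟩
    have := (aux_sphere_finite m).ne
    simpa using this
  have hC1 : ContDiffOn ℝ 1 (fderiv ℝ h) U := hC.fderiv_of_isOpen hU (by norm_num)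
  have hC2 : ContinuousOn (fderiv ℝ (fderiv ℝ h)) U :=
    hC1.continuousOn_fderiv_of_isOpen hU le_rfl
  have hd1 : ∀ x ∈ U, HasFDerivAt h (fderiv ℝ h x) x := fun x hx =>
    ((hC.differentiableOn two_ne_zero).differentiableAt (hU.mem_nhds hx)).hasFDerivAt
  have hd2 : ∀ x ∈ U, HasFDerivAt (fderiv ℝ h) (fderiv ℝ (fderiv ℝ h) x) x := fun x hx =>
    ((hC1.differentiableOn one_ne_zero).differentiableAt (hU.mem_nhds hx)).hasFDerivAt
  have hmem : ∀ s ∈ Set.Ioo ρ₀ ρ₁, ∀ θ ∈ Metric.sphere (0 : AuxE n) 1, s • θ ∈ U := by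
    intro s hs θ hθ
    have h1 : ‖θ‖ = 1 := by simpa using hθ
    have : ‖s • θ‖ = s := by
      rw [norm_smul, h1, mul_one, Real.norm_eq_abs, abs_of_pos (hρ₀.trans hs.1)]
    simp only [hUdef, mem_setOf_eq, this]
    exact hs
  have hsm : ∀ (s : ℝ) (θ : AuxE n), HasDerivAt (fun s : ℝ => s • θ) θ s := fun s θ => by
    simpa using (hasDerivAt_id s).smul_const θ
  refine ⟨fun r => ∫ θ in Metric.sphere (0 : AuxE n) 1, fderiv ℝ h (r • θ) θ ∂(μH[(n : ℝ) - 1]),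
    fun r => ∫ θ in Metric.sphere (0 : AuxE n) 1,
      fderiv ℝ (fderiv ℝ h) (r • θ) θ θ ∂(μH[(n : ℝ) - 1]), fun r hr => ?_⟩
  have hcs : Continuous (fun p : ℝ × AuxE n => p.1 • p.2) := by fun_prop
  have hms : MapsTo (fun p : ℝ × AuxE n => p.1 • p.2)
      (Set.Ioo ρ₀ ρ₁ ×ˢ Metric.sphere (0 : AuxE n) 1) U := fun p hp => hmem p.1 hp.1 p.2 hp.2
  obtain ⟨hi1, hD1⟩ := aux_hasDeriv μH[(n : ℝ) - 1] (isCompact_sphere (0 : AuxE n) 1) hfin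
    (fun s θ => h (s • θ)) (fun s θ => fderiv ℝ h (s • θ) θ) isOpen_Ioo hr
    (fun s hs => hC.continuousOn.comp (by fun_prop) (fun θ hθ => hmem s hs θ hθ))
    ((hC1.continuousOn.comp hcs.continuousOn hms).clm_apply continuousOn_snd)
    (fun s hs θ hθ => (hd1 _ (hmem s hs θ hθ)).comp_hasDerivAt s (hsm s θ))
  obtain ⟨hi2, hD2⟩ := aux_hasDeriv μH[(n : ℝ) - 1] (isCompact_sphere (0 : AuxE n) 1) hfin
    (fun s θ => fderiv ℝ h (s • θ) θ) (fun s θ => fderiv ℝ (fderiv ℝ h) (s • θ) θ θ)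
    isOpen_Ioo hr
    (fun s hs => (hC1.continuousOn.comp (by fun_prop)
      (fun θ hθ => hmem s hs θ hθ)).clm_apply continuousOn_id)
    (((hC2.comp hcs.continuousOn hms).clm_apply continuousOn_snd).clm_apply continuousOn_snd)
    (fun s hs θ hθ => by
      have h2 := (hd2 _ (hmem s hs θ hθ)).comp_hasDerivAt s (hsm s θ)
      have := h2.clm_apply (hasDerivAt_const s θ)
      simp only [map_zero, add_zero] at this
      exact this)
  refine ⟨hD1, hD2, ?_⟩
  have hr0 : 0 < r := hρ₀.trans hr.1
  have hrot := fun i j : Fin n => aux_rot hfin (auxA i j) (auxA_skew i j) hU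
    (fun x => fderiv ℝ h x (auxA i j x))
    (hC1.clm_apply (auxA i j).contDiff.contDiffOn) hr0
    (fun x hx => by simp only [hUdef, mem_setOf_eq, hx]; exact hr)
  have hsum : ∫ θ in Metric.sphere (0 : AuxE n) 1, (∑ i : Fin n, ∑ j : Fin n,
      fderiv ℝ (fun x => fderiv ℝ h x (auxA i j x)) (r • θ) (auxA i j θ)) ∂(μH[(n : ℝ) - 1])
      = 0 := by
    rw [integral_finsetSum _ (fun i _ => integrable_finsetSum _ (fun j _ => (hrot i j).1))]
    refine Finset.sum_eq_zero fun i _ => ?_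
    rw [integral_finsetSum _ (fun j _ => (hrot i j).1)]
    exact Finset.sum_eq_zero fun j _ => (hrot i j).2
  have hpt : ∀ θ ∈ Metric.sphere (0 : AuxE n) 1, (∑ i : Fin n, ∑ j : Fin n,
      fderiv ℝ (fun x => fderiv ℝ h x (auxA i j x)) (r • θ) (auxA i j θ))
      = (-2 * r) * fderiv ℝ (fderiv ℝ h) (r • θ) θ θ
        + (-(2 * ((n : ℝ) - 1))) * fderiv ℝ h (r • θ) θ := by
    intro θ hθ
    have hx := hmem r hr θ hθ
    have h1 : ‖θ‖ = 1 := by simpa using hθ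
    have hf : ∀ i j : Fin n,
        fderiv ℝ (fun x => fderiv ℝ h x (auxA i j x)) (r • θ) (auxA i j θ)
        = r * fderiv ℝ (fderiv ℝ h) (r • θ) (auxA i j θ) (auxA i j θ)
          + fderiv ℝ h (r • θ) (auxA i j (auxA i j θ)) := by
      intro i j
      rw [((hd2 _ hx).clm_apply (auxA i j).hasFDerivAt).fderiv]
      simp
      ring
    have hlap := hL _ hx
    have hlap' : ∑ i : Fin n, fderiv ℝ (fderiv ℝ h) (r • θ) (EuclideanSpace.single i (1:ℝ))
        (EuclideanSpace.single i (1:ℝ)) = 0 := by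
      rw [← hlap]
      refine Finset.sum_congr rfl fun i _ => ?_
      rw [((hd2 _ hx).clm_apply (hasFDerivAt_const (EuclideanSpace.single i (1:ℝ)) _)).fderiv]
      simp
    simp only [hf, Finset.sum_add_distrib, ← Finset.mul_sum, ← map_sum]
    rw [auxA_bil, auxA_sq, hlap', h1, map_smul, smul_eq_mul]
    ring
  rw [setIntegral_congr_fun (isCompact_sphere (0 : AuxE n) 1).measurableSet hpt,
    integral_add (hi2.const_mul _) (hi1.const_mul _), integral_const_mul,
    integral_const_mul] at hsum
  field_simp
  linarith
end
end
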